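/- Assume β ≥ α. There exists λ0 > 0 such that for every λ ≥ λ0 there exist constants C1, C2 > 0 with C1 (1 + |x|^{β−α}) ≤ 𝒱_λ(x) ≤ C2 (1 + |x|^{β−α}) for all x ∈ ℝ^N. -/

import Mathlib

open Real

/-- The potential `𝒱_λ` associated with the operator `A`. -/
noncomputable def pot (N : ℕ) (α β b c lam : ℝ) (x : EuclideanSpace ℝ (Fin N)) : ℝ :=
  (b ^ 2 / 4 - b * α / 2) * ‖x‖ ^ (2 * α - 2) / (1 + ‖x‖ ^ α) ^ 2
    + (b / 2) * ((N : ℝ) + α - 2) * ‖x‖ ^ (α - 2) / (1 + ‖x‖ ^ α)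
    + (c * ‖x‖ ^ β + lam) / (1 + ‖x‖ ^ α)

/-- Assume `β ≥ α`. There exists `λ0 > 0` such that for every `λ ≥ λ0`
there are constants `C1, C2 > 0` with
`C1 (1 + |x|^{β-α}) ≤ 𝒱_λ(x) ≤ C2 (1 + |x|^{β-α})` for all `x ∈ ℝ^N`. -/
theorem stmt14 (N : ℕ) (hN : 2 < N) (α β b c : ℝ) (hα : 2 < α) (hβ : α - 2 < β)
    (hc : 0 < c) (hβα : α ≤ β) :
    ∃ lam0 : ℝ, 0 < lam0 ∧ ∀ lam : ℝ, lam0 ≤ lam →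
      ∃ C1 C2 : ℝ, 0 < C1 ∧ 0 < C2 ∧ ∀ x : EuclideanSpace ℝ (Fin N),
        C1 * (1 + ‖x‖ ^ (β - α)) ≤ pot N α β b c lam x ∧
        pot N α β b c lam x ≤ C2 * (1 + ‖x‖ ^ (β - α)) := by
  obtain ⟨A, hA⟩ : ∃ A, A = b ^ 2 / 4 - b * α / 2 := ⟨_, rfl⟩
  obtain ⟨B, hB⟩ : ∃ B, B = (b / 2) * ((N : ℝ) + α - 2) := ⟨_, rfl⟩
  obtain ⟨K, hK⟩ : ∃ K, K = |A| + |B| := ⟨_, rfl⟩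
  have hK0 : 0 ≤ K := by rw [hK]; positivity
  obtain ⟨R, hR⟩ : ∃ R, R = 1 + 2 * K / c := ⟨_, rfl⟩
  have hq : 0 ≤ 2 * K / c := by positivity
  have hR1 : 1 ≤ R := by linarith
  have hKR : K ≤ c / 2 * R ^ 2 := by
    have h1 : K = c / 2 * (2 * K / c) := by field_simp
    have h2 : 2 * K / c ≤ R ^ 2 := by nlinarith
    calc K = c / 2 * (2 * K / c) := h1
      _ ≤ _ := by gcongr
  obtain ⟨M, hM⟩ : ∃ M, M = K * R ^ (α - 2) := ⟨_, rfl⟩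
  have hM0 : 0 ≤ M := by rw [hM]; positivity
  refine ⟨M + c / 2, by positivity, fun lam hlam => ⟨c / 6, 3 * c / 2 + lam + M, by positivity,
    by linarith, fun x => ?_⟩⟩
  have hr : 0 ≤ ‖x‖ := norm_nonneg x
  unfold pot
  rw [← hA, ← hB]
  generalize ‖x‖ = r at hr
  have e1 : r ^ (2 * α - 2) = r ^ α * r ^ (α - 2) := by
    rw [← rpow_add_of_nonneg hr (by linarith) (by linarith)]; congr 1; ring
  have e2 : r ^ β = r ^ α * r ^ (β - α) := by
    rw [← rpow_add_of_nonneg hr (by linarith) (by linarith)]; congr 1; ring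
  have e3 : r ^ α = r ^ (α - 2) * r ^ 2 := by
    rw [← rpow_natCast, ← rpow_add_of_nonneg hr (by linarith) (by norm_num)]; congr 1
    push_cast; ring
  have hu : 0 ≤ r ^ (α - 2) := by positivity
  have hs : 0 ≤ r ^ α := by positivity
  have hw : 0 ≤ r ^ (β - α) := by positivity
  have hcase : (r ^ α ≤ 1 ∧ r ^ (β - α) ≤ 1) ∨ (1 ≤ r ^ α ∧ 1 ≤ r ^ (β - α)) := by
    rcases le_total r 1 with h | h
    · exact Or.inl ⟨rpow_le_one hr h (by linarith), rpow_le_one hr h (by linarith)⟩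
    · exact Or.inr ⟨one_le_rpow h (by linarith), one_le_rpow h (by linarith)⟩
  have hKu : K * r ^ (α - 2) ≤ c / 2 * (r ^ α * r ^ (β - α)) + M := by
    rcases le_total r R with h | h
    · have : r ^ (α - 2) ≤ R ^ (α - 2) := rpow_le_rpow hr h (by linarith)
      have : K * r ^ (α - 2) ≤ M := by rw [hM]; gcongr
      have : 0 ≤ c / 2 * (r ^ α * r ^ (β - α)) := by positivity
      linarith
    · have h1 : 1 ≤ r ^ (β - α) := one_le_rpow (hR1.trans h) (by linarith)
      have h2 : R ^ 2 ≤ r ^ 2 := by gcongr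
      have h3 : K * r ^ (α - 2) ≤ c / 2 * r ^ α := by
        rw [e3]
        calc K * r ^ (α - 2) ≤ (c / 2 * r ^ 2) * r ^ (α - 2) := by
              gcongr
              exact hKR.trans (by gcongr)
          _ = _ := by ring
      have h4 : c / 2 * r ^ α ≤ c / 2 * (r ^ α * r ^ (β - α)) := by
        gcongr
        exact le_mul_of_one_le_right hs h1
      linarith
  rw [e1, e2]
  clear e1 e2 e3
  generalize r ^ (α - 2) = u at *
  generalize r ^ α = s at *
  generalize r ^ (β - α) = w at *
  have hD : 0 < 1 + s := by linarith
  have hsw : 0 ≤ s * w := by positivity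
  obtain ⟨t, ht⟩ : ∃ t, t = s / (1 + s) := ⟨_, rfl⟩
  have ht0 : 0 ≤ t := by rw [ht]; positivity
  have ht1 : t ≤ 1 := by rw [ht, div_le_one hD]; linarith
  have hE : A * (s * u) / (1 + s) ^ 2 + B * u / (1 + s) + (c * (s * w) + lam) / (1 + s)
      = ((A * t + B) * u + c * (s * w) + lam) / (1 + s) := by
    rw [ht]; field_simp; ring
  have habs : |A * t + B| ≤ K := by
    rw [hK]
    refine (abs_add_le _ _).trans ?_
    rw [abs_mul, abs_of_nonneg ht0]
    gcongr
    exact mul_le_of_le_one_right (abs_nonneg _) ht1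
  have hb1 : (A * t + B) * u ≤ K * u :=
    mul_le_mul_of_nonneg_right ((le_abs_self _).trans habs) hu
  have hb2 : -(K * u) ≤ (A * t + B) * u := by
    rw [← neg_mul]
    exact mul_le_mul_of_nonneg_right (abs_le.mp habs).1 hu
  have hw3 : w ≤ 1 + s * w := by rcases hcase with h | h <;> nlinarith
  have hs3 : s ≤ 1 + s * w := by rcases hcase with h | h <;> nlinarith
  rw [hE, le_div_iff₀ hD, div_le_iff₀ hD]
  constructor
  · have : (1 + w) * (1 + s) ≤ 3 * (1 + s * w) := by linarith
    have h6 := mul_le_mul_of_nonneg_left this (show 0 ≤ c / 6 by positivity)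
    linarith
  · have h1 : 0 ≤ w + s := by linarith
    have h2 : 0 ≤ lam + M := by linarith
    have h3 := mul_nonneg h2 h1
    have h4 := mul_nonneg h2 hsw
    have h5 := mul_nonneg hc.le h1
    linarith
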